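/- Let n ≥ 1, let a_1, …, a_n be pairwise distinct socks, and let p = a_1⋯a_n a_1⋯a_n. Then for every k with 1 ≤ k ≤ n, there exist sock sequences X_1, X_2, X_3 and q such that φ_{aba}^k(p) is the concatenation X_1 q X_2 q X_3, the entries of q are pairwise distinct, |q| = n − k, |X_1| = 2⌊k/3⌋, |X_2| = 2⌊(k+1)/3⌋, and |X_3| = 2⌊(k+2)/3⌋. -/

import Mathlib

attribute [local instance] Classical.propDecidable

/-- Two lists have the same shape: same length and identical equality pattern
of entries (`q_i = q_j` iff `r_i = r_j`). -/
def SameShape {A : Type*} {B : Type*} (q : List A) (r : List B) : Prop :=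
  q.length = r.length ∧ ∀ i j : ℕ, (q[i]? = q[j]? ↔ r[i]? = r[j]?)

/-- `ContainsPat p σ` : the sock sequence `p` contains the pattern `σ`
(not necessarily consecutively): there are indices `i_1 < ⋯ < i_m` such that
`p_{i_j} = p_{i_k} ↔ σ_j = σ_k`. -/
def ContainsPat {A : Type*} {B : Type*} (p : List A) (σ : List B) : Prop :=
  ∃ q : List A, q.Sublist p ∧ SameShape q σ

/-- A sock sequence is sorted if all occurrences of each sock appear
consecutively. -/
def SortedSocks {A : Type*} (p : List A) : Prop :=
  ∀ i j k : ℕ, i ≤ j → j ≤ k → p[i]? = p[k]? → p[j]? = p[i]?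

/-- One pass of the deterministic σ-avoiding stack-sorting procedure:
`sortAux σ input stack` runs the σ-avoiding stack with the given remaining
input and current stack (stack listed from top to bottom), returning the rest
of the output.  If input remains and pushing the next input sock onto the
stack does not create a σ-pattern in the stack, that sock is pushed; otherwise
the top sock of the stack is popped to the output. -/
noncomputable def sortAux {A : Type*} {B : Type*} (σ : List B) : List A → List A → List A
  | [], stack => stack
  | x :: input, stack =>
    if ContainsPat (x :: stack) σ then
      match stack with
      | [] => sortAux σ input [x]
      | t :: rest => t :: sortAux σ (x :: input) rest
    else
      sortAux σ input (x :: stack)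
termination_by input stack => 2 * input.length + stack.length
decreasing_by all_goals simp only [List.length_cons]; omega

/-- The deterministic σ-avoiding stack-sorting map `φ_σ`. -/
noncomputable def phi {A : Type*} {B : Type*} (σ : List B) (p : List A) : List A :=
  sortAux σ p []

/-- The pattern `aba`: first and third socks equal, distinct from the second. -/
def abaPat : List ℕ := [0, 1, 0]

theorem containsPat_abaPat_iff {A : Type*} {s : List A} :
    ContainsPat s abaPat ↔ ∃ x y : A, x ≠ y ∧ [x, y, x].Sublist s := by
  constructor
  · rintro ⟨q, hq, hlen, h⟩
    obtain ⟨x, y, z, rfl⟩ := List.length_eq_three.mp hlen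
    have hxz : x = z := by simpa [abaPat] using h 0 2
    have hxy : x ≠ y := by simpa [abaPat] using h 0 1
    subst hxz
    exact ⟨x, y, hxy, hq⟩
  · rintro ⟨x, y, hxy, hs⟩
    refine ⟨_, hs, rfl, fun i j => ?_⟩
    rcases i with _ | _ | _ | i <;> rcases j with _ | _ | _ | j <;>
      simp [abaPat, hxy, hxy.symm]

theorem ContainsPat.mono {A B : Type*} {s t : List A} {σ : List B} (h : ContainsPat s σ)
    (hst : s.Sublist t) : ContainsPat t σ :=
  let ⟨q, hq, hσ⟩ := h
  ⟨q, hq.trans hst, hσ⟩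

theorem not_containsPat_cons_of_notMem {A : Type*} {x : A} {s : List A}
    (hs : ¬ ContainsPat s abaPat) (hx : x ∉ s) : ¬ ContainsPat (x :: s) abaPat := by
  rw [containsPat_abaPat_iff] at *
  rintro ⟨a, b, hab, h⟩
  cases h with
  | cons _ h => exact hs ⟨a, b, hab, h⟩
  | cons_cons _ h => exact hx (h.subset (by simp))

theorem not_containsPat_cons_cons_self {A : Type*} {x : A} {s : List A}
    (hs : ¬ ContainsPat (x :: s) abaPat) : ¬ ContainsPat (x :: x :: s) abaPat := by
  rw [containsPat_abaPat_iff] at *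
  rintro ⟨a, b, hab, h⟩
  cases h with
  | cons _ h => exact hs ⟨a, b, hab, h⟩
  | cons_cons _ h =>
    cases h with
    | cons _ h => exact hs ⟨x, b, hab, h.cons_cons x⟩
    | cons_cons _ h => exact hab rfl

/-- Every entry of the list repeated twice in place. -/
def double {A : Type*} (l : List A) : List A :=
  l.flatMap fun x => [x, x]

theorem double_cons {A : Type*} (x : A) (l : List A) : double (x :: l) = x :: x :: double l := rfl

theorem double_append {A : Type*} (l m : List A) : double (l ++ m) = double l ++ double m :=
  List.flatMap_append

theorem reverse_double {A : Type*} (l : List A) : (double l).reverse = double l.reverse := by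
  induction l with
  | nil => rfl
  | cons x l ih => simp [double_cons, double_append, ih]; rfl

theorem length_double {A : Type*} (l : List A) : (double l).length = 2 * l.length := by
  simp [double, mul_comm]

theorem mem_double {A : Type*} {x : A} {l : List A} : x ∈ double l ↔ x ∈ l := by
  simp [double]

theorem sublist_double {A : Type*} (l : List A) : l.Sublist (double l) := by
  induction l with
  | nil => exact List.Sublist.refl _
  | cons x l ih => exact (ih.cons x).cons_cons x

theorem not_containsPat_double {A : Type*} {l : List A} (hl : l.Nodup) :
    ¬ ContainsPat (double l) abaPat := by
  induction l with
  | nil => simp [containsPat_abaPat_iff, double]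
  | cons x l ih =>
    rw [List.nodup_cons] at hl
    exact not_containsPat_cons_cons_self
      (not_containsPat_cons_of_notMem (ih hl.2) (by simpa [mem_double] using hl.1))

theorem sortAux_push {A B : Type*} {σ : List B} (w input s : List A)
    (h : ¬ ContainsPat (w.reverse ++ s) σ) :
    sortAux σ (w ++ input) s = sortAux σ input (w.reverse ++ s) := by
  induction w generalizing s with
  | nil => rfl
  | cons x w ih =>
    rw [List.reverse_cons, List.append_assoc] at *
    have hx : ¬ ContainsPat (x :: s) σ := fun hc => h (hc.mono (List.sublist_append_right _ _))
    rw [List.cons_append, sortAux.eq_def]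
    simp only [if_neg hx]
    exact ih _ h

theorem sortAux_pop {A : Type*} {x : A} (w input s : List A) (hx : x ∉ w) :
    sortAux abaPat (x :: input) (w ++ x :: s) = w ++ sortAux abaPat (x :: input) (x :: s) := by
  induction w with
  | nil => rfl
  | cons t w ih =>
    rw [List.mem_cons, not_or] at hx
    have hc : ContainsPat (x :: t :: (w ++ x :: s)) abaPat :=
      containsPat_abaPat_iff.mpr ⟨x, t, hx.1, by simp⟩
    rw [List.cons_append, sortAux, if_pos hc, ih hx.2, List.cons_append]

theorem phi_abaPat_double {A : Type*} (x : A) (q D₁ D₂ D₃ : List A)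
    (h : (D₁ ++ x :: q ++ D₂ ++ D₃).Nodup) :
    phi abaPat (double D₁ ++ x :: q ++ double D₂ ++ x :: q ++ double D₃) =
      double D₂.reverse ++ q.reverse ++ double D₃.reverse ++ q.reverse ++
        double (x :: D₁.reverse) := by
  have hpush : ¬ ContainsPat ((double D₁ ++ x :: q ++ double D₂).reverse ++ []) abaPat := by
    have hE : (D₁ ++ x :: q ++ D₂).reverse.Nodup := List.nodup_reverse.mpr h.of_append_left
    refine fun hc => not_containsPat_double hE (hc.mono ?_)
    rw [← reverse_double, List.append_nil, List.reverse_sublist, double_append, double_append]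
    exact ((List.Sublist.refl _).append (sublist_double _)).append (List.Sublist.refl _)
  have hpush' : ¬ ContainsPat ((x :: q ++ double D₃).reverse ++ x :: double D₁.reverse)
      abaPat := by
    have hE : (D₁ ++ x :: q ++ D₃).reverse.Nodup := by
      refine List.nodup_reverse.mpr (h.sublist ?_)
      exact (List.sublist_append_left _ _).append (List.Sublist.refl _)
    refine fun hc => not_containsPat_double hE (hc.mono ?_)
    rw [← reverse_double, ← reverse_double]
    have : (x :: q ++ double D₃).reverse ++ x :: (double D₁).reverse
        = (double D₁ ++ x :: x :: q ++ double D₃).reverse := by simp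
    rw [this, List.reverse_sublist, double_append, double_append, double_cons]
    exact ((List.Sublist.refl _).append (((sublist_double q).cons_cons x).cons_cons x)).append
      (List.Sublist.refl _)
  have hx : x ∉ double D₂.reverse ++ q.reverse := by
    simp only [List.nodup_append, List.nodup_cons] at h
    simp only [List.mem_append, mem_double, List.mem_reverse]
    grind
  have hstack : (double D₁ ++ x :: q ++ double D₂).reverse ++ []
      = (double D₂.reverse ++ q.reverse) ++ x :: double D₁.reverse := by
    simp [reverse_double]
  have hinput : double D₁ ++ x :: q ++ double D₂ ++ x :: q ++ double D₃
      = (double D₁ ++ x :: q ++ double D₂) ++ (x :: (q ++ double D₃ ++ [])) := by simp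
  have hsecond := sortAux_push (x :: q ++ double D₃) [] _ hpush'
  rw [List.cons_append, List.cons_append] at hsecond
  rw [phi, hinput, sortAux_push _ _ _ hpush, hstack, sortAux_pop _ _ _ hx, hsecond, sortAux]
  simp [reverse_double, double_cons]

theorem exists_iterate_phi_abaPat_eq_double {A : Type*} (l : List A) (hl : l.Nodup) (k : ℕ)
    (hk : k ≤ l.length) :
    ∃ D₁ D₂ D₃ q : List A,
      (phi abaPat)^[k] (l ++ l) = double D₁ ++ q ++ double D₂ ++ q ++ double D₃ ∧
      (D₁ ++ q ++ D₂ ++ D₃).Nodup ∧ q.length = l.length - k ∧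
      D₁.length = k / 3 ∧ D₂.length = (k + 1) / 3 ∧ D₃.length = (k + 2) / 3 := by
  induction k with
  | zero => exact ⟨[], [], [], l, by simp [double], by simpa using hl, by simp⟩
  | succ k ih =>
    obtain ⟨D₁, D₂, D₃, q, heq, hnd, hq, h₁, h₂, h₃⟩ := ih (by omega)
    obtain _ | ⟨x, q⟩ := q
    · simp at hq; omega
    refine ⟨D₂.reverse, D₃.reverse, x :: D₁.reverse, q.reverse, ?_, ?_, ?_, ?_, ?_, ?_⟩
    · rw [Function.iterate_succ_apply', heq, phi_abaPat_double x q D₁ D₂ D₃ hnd]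
    · simp only [List.nodup_append, List.nodup_cons, List.nodup_reverse] at hnd ⊢
      grind
    all_goals simp at hq ⊢; omega

/-- For `n ≥ 1`, pairwise distinct socks `a_1, …, a_n`, and
`p = a_1⋯a_n a_1⋯a_n`, for every `1 ≤ k ≤ n` the iterate `φ_{aba}^k(p)` has
the form `X_1 q X_2 q X_3` where the entries of `q` are pairwise distinct,
`|q| = n - k`, `|X_1| = 2⌊k/3⌋`, `|X_2| = 2⌊(k+1)/3⌋`, `|X_3| = 2⌊(k+2)/3⌋`. -/
theorem iterate_structure {A : Type*} (n : ℕ) (hn : 1 ≤ n)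
    (a : Fin n → A) (ha : Function.Injective a) :
    ∀ k : ℕ, 1 ≤ k → k ≤ n →
      ∃ X₁ X₂ X₃ q : List A,
        (phi abaPat)^[k] (List.ofFn a ++ List.ofFn a)
          = X₁ ++ q ++ X₂ ++ q ++ X₃ ∧
        q.Nodup ∧ q.length = n - k ∧
        X₁.length = 2 * (k / 3) ∧
        X₂.length = 2 * ((k + 1) / 3) ∧
        X₃.length = 2 * ((k + 2) / 3) := by
  intro k _ hk
  obtain ⟨D₁, D₂, D₃, q, heq, hnd, hq, h₁, h₂, h₃⟩ :=
    exists_iterate_phi_abaPat_eq_double (List.ofFn a) (List.nodup_ofFn.mpr ha) k (by simpa using hk)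
  refine ⟨_, _, _, q, heq, hnd.of_append_left.of_append_left.of_append_right, by simpa using hq, ?_⟩
  simp only [length_double, h₁, h₂, h₃, and_self]
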